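/- Let X be a simplicial complex on vertex set V and let U ⊆ V satisfy U ∉ X and, for every missing face τ of X, |τ \ U| ≤ 1. Then X is (|U| − 1)-representable, i.e., X is the nerve of a family of compact convex sets in ℝ^{|U|−1} indexed by V. -/

import Mathlib

/-- A simplicial complex: a family of finite subsets closed under subsets. -/
def IsSimplicialComplex {α : Type*} (X : Set (Finset α)) : Prop :=
  ∀ σ ∈ X, ∀ τ, τ ⊆ σ → τ ∈ X

/-- `τ` is a missing face of `X`. -/
def IsMissingFace {α : Type*} (X : Set (Finset α)) (τ : Finset α) : Prop :=
  τ ∉ X ∧ ∀ σ, σ ⊂ τ → σ ∈ X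

/-- `X` is d-representable: it is the nerve of a family of compact convex sets in ℝ^d. -/
def IsRepresentable {α : Type*} (d : ℕ) (X : Set (Finset α)) : Prop :=
  ∃ C : α → Set (EuclideanSpace ℝ (Fin d)),
    (∀ v, IsCompact (C v) ∧ Convex ℝ (C v)) ∧
      ∀ σ : Finset α, σ ∈ X ↔ (⋂ v ∈ σ, C v).Nonempty

theorem exists_coords {α : Type*} [DecidableEq α] (U : Finset α) (hU : 1 ≤ U.card) :
    ∃ (f : U → (EuclideanSpace ℝ (Fin (U.card - 1)) →ᵃ[ℝ] ℝ))
      (x : Finset α → EuclideanSpace ℝ (Fin (U.card - 1))),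
      ∀ D : Finset α, ¬ U ⊆ D → ∀ u : U,
        ((u : α) ∈ D → f u (x D) = 0) ∧ ((u : α) ∉ D → 0 < f u (x D)) := by
  have hc : Fintype.card U
      = Module.finrank ℝ (EuclideanSpace ℝ (Fin (U.card - 1))) + 1 := by
    simp
    omega
  obtain ⟨b⟩ := AffineBasis.exists_affineBasis_of_finiteDimensional
    (k := ℝ) (P := EuclideanSpace ℝ (Fin (U.card - 1))) hc
  refine ⟨fun u => b.coord u,
    fun D => (Finset.univ.filter (fun u : U => (u : α) ∉ D)).centroid ℝ b, ?_⟩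
  intro D hD u
  have hne : (Finset.univ.filter (fun u : U => (u : α) ∉ D)).Nonempty := by
    obtain ⟨a, ha, haD⟩ := Finset.not_subset.1 hD
    exact ⟨⟨a, ha⟩, by simpa using haD⟩
  constructor
  · intro hu
    exact b.coord_apply_combination_of_notMem (by simpa using hu)
      (Finset.sum_centroidWeights_eq_one_of_nonempty ℝ _ hne)
  · intro hu
    have : b.coord u ((Finset.univ.filter (fun u : U => (u : α) ∉ D)).centroid ℝ b) = _ :=
      b.coord_apply_centroid (by simpa using hu)
    rw [this]
    have := Finset.card_pos.2 hne
    positivity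

theorem exists_missing {α : Type*} [DecidableEq α] (X : Set (Finset α)) (σ : Finset α)
    (h : σ ∉ X) : ∃ τ, τ ⊆ σ ∧ IsMissingFace X τ := by
  induction σ using Finset.strongInduction with
  | H σ ih =>
    by_cases hm : ∀ ρ, ρ ⊂ σ → ρ ∈ X
    · exact ⟨σ, subset_rfl, h, hm⟩
    · push Not at hm
      obtain ⟨ρ, h1, h2⟩ := hm
      obtain ⟨τ, h3, h4⟩ := ih ρ h1 h2
      exact ⟨τ, h3.trans h1.subset, h4⟩

/-- If `U ∉ X` and every missing face `τ` of `X` satisfies `|τ \ U| ≤ 1`,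
then `X` is `(|U| − 1)`-representable. -/
theorem representable_of_dominating_set {α : Type*} [Fintype α] [DecidableEq α]
    (X : Set (Finset α)) (hX : IsSimplicialComplex X)
    (hempty : ∅ ∈ X) (hsing : ∀ v : α, {v} ∈ X)
    (U : Finset α) (hU : U ∉ X)
    (hdom : ∀ τ : Finset α, IsMissingFace X τ → (τ \ U).card ≤ 1) :
    IsRepresentable (U.card - 1) X := by
  have hU1 : 1 ≤ U.card := by
    rw [Nat.one_le_iff_ne_zero, Finset.card_ne_zero, Finset.nonempty_iff_ne_empty]
    rintro rfl
    exact hU hempty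
  obtain ⟨f, x, hfx⟩ := exists_coords U hU1
  let S : α → Set (Finset α) := fun w => {D | insert w D ∈ X ∧ (w ∈ U → w ∈ D)}
  have hSU : ∀ w, ∀ D ∈ S w, ¬ U ⊆ D := fun w D hD h =>
    hU (hX _ hD.1 _ (h.trans (Finset.subset_insert _ _)))
  refine ⟨fun w => convexHull ℝ (x '' S w), fun v =>
    ⟨((Set.toFinite (S v)).image x).isCompact_convexHull ℝ, convex_convexHull _ _⟩, ?_⟩
  intro σ
  constructor
  · intro hσ
    refine ⟨x (σ ∩ U), ?_⟩
    simp only [Set.mem_iInter]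
    intro w hw
    refine subset_convexHull _ _ ⟨_, ⟨?_, ?_⟩, rfl⟩
    · exact hX _ hσ _ (Finset.insert_subset hw Finset.inter_subset_left)
    · intro h
      exact Finset.mem_inter.2 ⟨hw, h⟩
  · rintro ⟨y, hy⟩
    simp only [Set.mem_iInter] at hy
    by_contra hσ
    obtain ⟨τ, hτσ, hτ⟩ := exists_missing X σ hσ
    have hcard := hdom τ hτ
    obtain ⟨w, hw, hτw⟩ : ∃ w ∈ τ, ∀ z ∈ τ, z ∉ U → z = w := by
      by_cases hne : (τ \ U).Nonempty
      · obtain ⟨w, hw⟩ := hne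
        refine ⟨w, (Finset.mem_sdiff.1 hw).1, fun z hz hzU => ?_⟩
        exact Finset.card_le_one.1 hcard z (Finset.mem_sdiff.2 ⟨hz, hzU⟩) w hw
      · obtain ⟨w, hw⟩ : τ.Nonempty := by
          rw [Finset.nonempty_iff_ne_empty]
          rintro rfl
          exact hτ.1 hempty
        exact ⟨w, hw, fun z hz hzU => (hne ⟨z, Finset.mem_sdiff.2 ⟨hz, hzU⟩⟩).elim⟩
    have hzero : ∀ u : U, (u : α) ∈ τ → f u y = 0 := by
      intro u hu
      have hsub : convexHull ℝ (x '' S u) ⊆ (f u) ⁻¹' {0} := by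
        refine convexHull_min ?_ ((convex_singleton 0).affine_preimage (f u))
        rintro _ ⟨D, hD, rfl⟩
        exact (hfx D (hSU _ D hD) u).1 (hD.2 u.2)
      exact hsub (hy u (hτσ hu))
    let T : Finset U := Finset.univ.filter (fun u : U => (u : α) ∈ τ)
    let g : EuclideanSpace ℝ (Fin (U.card - 1)) →ᵃ[ℝ] ℝ := ∑ u ∈ T, f u
    have hg : ∀ z, g z = ∑ u ∈ T, f u z := by
      intro z
      simp only [g]
      induction T using Finset.induction_on with
      | empty => simp
      | insert a s ha ih => simp [Finset.sum_insert ha, ih]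
    have hgy : g y = 0 := by
      rw [hg]
      exact Finset.sum_eq_zero fun u hu => hzero u (Finset.mem_filter.1 hu).2
    have hsub : convexHull ℝ (x '' S w) ⊆ g ⁻¹' (Set.Ioi 0) := by
      refine convexHull_min ?_ ((convex_Ioi 0).affine_preimage g)
      rintro _ ⟨D, hD, rfl⟩
      have hDU := hSU _ D hD
      obtain ⟨z, hz, hzD⟩ : ∃ z ∈ τ, z ∉ insert w D := by
        by_contra! hcon
        exact hτ.1 (hX _ hD.1 _ hcon)
      have hzU : z ∈ U := by
        by_contra h
        exact hzD (by rw [hτw z hz h]; exact Finset.mem_insert_self _ _)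
      have hzD' : z ∉ D := fun h => hzD (Finset.mem_insert_of_mem h)
      change 0 < g (x D)
      rw [hg]
      refine Finset.sum_pos' (fun u _ => ?_) ⟨⟨z, hzU⟩, by simpa [T] using hz, ?_⟩
      · by_cases h : (u : α) ∈ D
        · exact ((hfx D hDU u).1 h).ge
        · exact ((hfx D hDU u).2 h).le
      · exact (hfx D hDU ⟨z, hzU⟩).2 hzD'
    have := hsub (hy w (hτσ hw))
    have h0 : 0 < g y := this
    rw [hgy] at h0
    exact lt_irrefl _ h0
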